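/- Let D be a bounded open subset of R^d, a ∈ (0,|D|), and let Ω* solve the problem: minimize λ₁(Ω) over open Ω ⊂ D with |Ω| = a. Set u = u_{Ω*} and λ_a = λ₁(Ω*). Then λ_a = ∫_D|∇u|² = min{ ∫_D|∇v|² : v ∈ H¹₀(D), ∫_D v² = 1, |Ω_v| ≤ a }, and consequently u satisfies J(u) ≤ J(w) for all w ∈ H¹₀(D) with |Ω_w| ≤ a, where J(w) := ∫_D|∇w|² − λ_a∫_D w². -/

import Mathlib

open MeasureTheory Filter Metric Set
open scoped RealInnerProductSpace ENNReal Topology NNReal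

noncomputable section

abbrev Euc (d : ℕ) := EuclideanSpace ℝ (Fin d)

variable {d : ℕ}

/-- Real-valued Lebesgue volume of a set. -/
def mvol (s : Set (Euc d)) : ℝ := (volume s).toReal

/-- Smooth scalar test function compactly supported in `Ω`. -/
def TestFun (Ω : Set (Euc d)) (φ : Euc d → ℝ) : Prop :=
  ContDiff ℝ (⊤ : ℕ∞) φ ∧ HasCompactSupport φ ∧ tsupport φ ⊆ Ω

/-- Smooth vector field compactly supported in `Ω`. -/
def VecTestFun (Ω : Set (Euc d)) (Φ : Euc d → Euc d) : Prop :=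
  ContDiff ℝ (⊤ : ℕ∞) Φ ∧ HasCompactSupport Φ ∧ tsupport Φ ⊆ Ω

/-- Membership in `H¹₀(Ω)`, encoded through `L²` integrability of the function and of its
(a.e. defined) gradient, together with approximation in the `H¹` norm by smooth functions
compactly supported in `Ω`. -/
def MemH10 (Ω : Set (Euc d)) (v : Euc d → ℝ) : Prop :=
  MemLp v 2 (volume : Measure (Euc d)) ∧
  MemLp (fun x => gradient v x) 2 (volume : Measure (Euc d)) ∧
  ∃ φ : ℕ → Euc d → ℝ, (∀ n, TestFun Ω (φ n)) ∧
    Tendsto (fun n => ∫ x, ((v x - φ n x) ^ 2 + ‖gradient v x - gradient (φ n) x‖ ^ 2))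
      atTop (nhds 0)

/-- First Dirichlet eigenvalue of `Ω`, via the Rayleigh quotient variational characterization. -/
def lam1 (Ω : Set (Euc d)) : ℝ :=
  sInf {t : ℝ | ∃ v : Euc d → ℝ, MemH10 Ω v ∧ (∫ x, (v x) ^ 2) = 1 ∧
    t = ∫ x, ‖gradient v x‖ ^ 2}

/-- `u` is a normalized first Dirichlet eigenfunction of `Ω`. -/
def IsFirstEigenfun (Ω : Set (Euc d)) (u : Euc d → ℝ) : Prop :=
  MemH10 Ω u ∧ (∫ x, (u x) ^ 2) = 1 ∧ (∫ x, ‖gradient u x‖ ^ 2) = lam1 Ω ∧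
  ∀ φ : Euc d → ℝ, TestFun Ω φ →
    (∫ x, ⟪gradient u x, gradient φ x⟫) = lam1 Ω * ∫ x, u x * φ x

/-- `Ω` solves the shape optimization problem: it minimizes `λ₁` among open subsets of `D` of
measure `a`. -/
structure IsOptimalShape (D : Set (Euc d)) (a : ℝ) (Ω : Set (Euc d)) : Prop where
  isOpen : IsOpen Ω
  subset : Ω ⊆ D
  meas : mvol Ω = a
  minim : ∀ Ω' : Set (Euc d), IsOpen Ω' → Ω' ⊆ D → mvol Ω' = a → lam1 Ω ≤ lam1 Ω'

/-- `u` is locally Lipschitz continuous in `s`. -/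
def LocLipOn (s : Set (Euc d)) (u : Euc d → ℝ) : Prop :=
  ∀ x ∈ s, ∃ t, t ∈ 𝓝 x ∧ t ⊆ s ∧ ∃ K : ℝ≥0, LipschitzOnWith K u t

/-- Divergence of a vector field. -/
def divg (Φ : Euc d → Euc d) (x : Euc d) : ℝ :=
  ∑ i, fderiv ℝ Φ x (EuclideanSpace.single i 1) i

/-- `Ω` has locally finite perimeter in `D` (its characteristic function has locally bounded
variation in `D`). -/
def HasLocFinPerimeterIn (D Ω : Set (Euc d)) : Prop :=
  ∀ K : Set (Euc d), IsCompact K → K ⊆ D → ∃ C : ℝ,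
    ∀ Φ : Euc d → Euc d, VecTestFun K Φ → (∀ x, ‖Φ x‖ ≤ 1) →
      (∫ x in Ω, divg Φ x) ≤ C

/-- The reduced boundary of `Ω`: points where `Ω` blows up to a half space, in the sense that the
symmetric difference with a half space is of vanishing density. -/
def reducedBoundary (Ω : Set (Euc d)) : Set (Euc d) :=
  {x | ∃ ν : Euc d, ‖ν‖ = 1 ∧
    Tendsto (fun r : ℝ =>
        volume (symmDiff (Ω ∩ ball x r) ({y | ⟪y - x, ν⟫ ≤ 0} ∩ ball x r)) /
          ENNReal.ofReal (r ^ d))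
      (𝓝[>] 0) (𝓝 0)}

/-- `S` is an analytic hypersurface in `D`: near each of its points in `D` it is the zero set of
an analytic function with nonvanishing gradient. -/
def IsAnalyticHypersurfaceIn (D S : Set (Euc d)) : Prop :=
  ∀ x ∈ S ∩ D, ∃ U : Set (Euc d), IsOpen U ∧ x ∈ U ∧ U ⊆ D ∧
    ∃ f : Euc d → ℝ, AnalyticOn ℝ f U ∧ (∀ y ∈ U, fderiv ℝ f y ≠ 0) ∧
      S ∩ U = {y ∈ U | f y = 0}

/-- The functional `J(v) = ∫ |∇v|² - λ ∫ v²`. -/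
def Jfun (lam : ℝ) (v : Euc d → ℝ) : ℝ :=
  (∫ x, ‖gradient v x‖ ^ 2) - lam * ∫ x, (v x) ^ 2

/-- `Ω_v = {x ∈ D : v(x) ≠ 0}`. -/
def Om (D : Set (Euc d)) (v : Euc d → ℝ) : Set (Euc d) := {x ∈ D | v x ≠ 0}

/-- The optimal value `λ_a` of `λ₁` among open subsets of `D` of measure `a`. -/
def lamOpt (D : Set (Euc d)) (a : ℝ) : ℝ :=
  sInf {t : ℝ | ∃ Ω : Set (Euc d), IsOpen Ω ∧ Ω ⊆ D ∧ mvol Ω = a ∧ t = lam1 Ω}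

/-- `u` minimizes `J` among functions of `H¹₀(D)` with `|Ω_w| ≤ a`. -/
def IsJMinimizer (D : Set (Euc d)) (a lam : ℝ) (u : Euc d → ℝ) : Prop :=
  MemH10 D u ∧ mvol (Om D u) ≤ a ∧
  ∀ w : Euc d → ℝ, MemH10 D w → mvol (Om D w) ≤ a → Jfun lam u ≤ Jfun lam w

/-- The class `F` of perturbations of `u` supported in `B`. -/
def Fcal (D B : Set (Euc d)) (u v : Euc d → ℝ) : Prop :=
  MemH10 D v ∧ MemH10 B (fun x => u x - v x)

/-- The set of penalization constants `μ₋` admissible for `h` (inward perturbations). -/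
def Mminus (D : Set (Euc d)) (a lam : ℝ) (u : Euc d → ℝ) (B : Set (Euc d)) (h : ℝ) :
    Set ℝ :=
  {μ : ℝ | 0 ≤ μ ∧ ∀ v : Euc d → ℝ, Fcal D B u v →
    a - h ≤ mvol (Om D v) → mvol (Om D v) ≤ a →
    Jfun lam u + μ * mvol (Om D u) ≤ Jfun lam v + μ * mvol (Om D v)}

/-- The set of penalization constants `μ₊` admissible for `h` (outward perturbations). -/
def Mplus (D : Set (Euc d)) (a lam : ℝ) (u : Euc d → ℝ) (B : Set (Euc d)) (h : ℝ) :
    Set ℝ :=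
  {μ : ℝ | 0 ≤ μ ∧ ∀ v : Euc d → ℝ, Fcal D B u v →
    a ≤ mvol (Om D v) → mvol (Om D v) ≤ a + h →
    Jfun lam u + μ * mvol (Om D u) ≤ Jfun lam v + μ * mvol (Om D v)}

/-- `μ₋(h)`: the biggest admissible inward penalization constant. -/
def muMinus (D : Set (Euc d)) (a lam : ℝ) (u : Euc d → ℝ) (B : Set (Euc d)) (h : ℝ) : ℝ :=
  sSup (Mminus D a lam u B h)

/-- `μ₊(h)`: the smallest admissible outward penalization constant. -/
def muPlus (D : Set (Euc d)) (a lam : ℝ) (u : Euc d → ℝ) (B : Set (Euc d)) (h : ℝ) : ℝ :=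
  sInf (Mplus D a lam u B h)

/-- Average of `u` on the sphere `∂B(x,r)`, with respect to the `(d-1)`-Hausdorff measure. -/
def sphAvg (u : Euc d → ℝ) (x : Euc d) (r : ℝ) : ℝ :=
  (∫ y in sphere x r, u y ∂(μH[(d : ℝ) - 1])) / ((μH[(d : ℝ) - 1]) (sphere x r)).toReal


lemma exists_step (ε : ℝ) (hε : 0 < ε) : ∃ S : ℝ → ℝ, ContDiff ℝ (⊤ : ℕ∞) S ∧
    (∀ t, 0 ≤ S t) ∧ (∀ t, S t ≤ 1) ∧ (∀ t, |t| ≤ ε / 2 → S t = 0) ∧ (∀ t, ε ≤ |t| → S t = 1) ∧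
    (∀ t, S t = 0 → deriv S t = 0) ∧ (∀ t, S t = 1 → deriv S t = 0) ∧
    ∃ C, 0 ≤ C ∧ ∀ t, |deriv S t| ≤ C := by
  set S : ℝ → ℝ := fun t => Real.smoothTransition (2 * t ^ 2 / ε ^ 2 - 1) with hS
  have h1 : ContDiff ℝ (⊤ : ℕ∞) S := by
    apply Real.smoothTransition.contDiff.comp
    fun_prop
  have h2 : ∀ t, 0 ≤ S t := fun t => Real.smoothTransition.nonneg _
  have h3 : ∀ t, S t ≤ 1 := fun t => Real.smoothTransition.le_one _
  have h5 : ∀ t, ε ≤ |t| → S t = 1 := by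
    intro t ht
    apply Real.smoothTransition.one_of_one_le
    have : ε ^ 2 ≤ t ^ 2 := by rw [← sq_abs t]; gcongr
    have : 1 ≤ t ^ 2 / ε ^ 2 := by rw [le_div_iff₀ (by positivity)]; linarith
    rw [mul_div_assoc]; linarith
  have h7 : ∀ t, S t = 1 → deriv S t = 0 := by
    intro t ht
    apply IsLocalMax.deriv_eq_zero
    exact Filter.Eventually.of_forall fun y => by rw [ht]; exact h3 y
  refine ⟨S, h1, h2, h3, ?_, h5, ?_, h7, ?_⟩
  · intro t ht
    apply Real.smoothTransition.zero_of_nonpos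
    have : t ^ 2 ≤ (ε / 2) ^ 2 := by rw [← sq_abs t]; gcongr
    have : t ^ 2 / ε ^ 2 ≤ 1 / 4 := by rw [div_le_iff₀ (by positivity)]; linarith
    rw [mul_div_assoc]; linarith
  · intro t ht
    apply IsLocalMin.deriv_eq_zero
    exact Filter.Eventually.of_forall fun y => by rw [ht]; exact h2 y
  · have hc : Continuous (deriv S) := h1.continuous_deriv (by simp)
    obtain ⟨C, hC⟩ := (isCompact_Icc (a := -ε) (b := ε)).exists_bound_of_continuousOn hc.continuousOn
    refine ⟨max C 0, le_max_right _ _, fun t => ?_⟩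
    by_cases ht : ε ≤ |t|
    · rw [h7 t (h5 t ht)]; simp
    · push Not at ht
      exact (hC t ⟨(abs_lt.1 ht).1.le, (abs_lt.1 ht).2.le⟩).trans (le_max_left _ _)

lemma exists_trunc (ε : ℝ) (hε : 0 < ε) : ∃ T : ℝ → ℝ, ContDiff ℝ (⊤ : ℕ∞) T ∧
    (∀ t, |t| ≤ ε / 2 → T t = 0) ∧ (∀ t, |T t - t| ≤ ε) ∧ (∀ t, |deriv T t| ≤ 1) := by
  obtain ⟨S, h1, h2, h3, h4, h5, -, -, -⟩ := exists_step ε hε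
  have hc : Continuous S := h1.continuous
  have hd : ∀ t, HasDerivAt (fun t => ∫ s in (0:ℝ)..t, S s) (S t) t := fun t =>
    intervalIntegral.integral_hasDerivAt_right (hc.intervalIntegrable _ _)
      (hc.stronglyMeasurableAtFilter _ _) hc.continuousAt
  have hd' : deriv (fun t => ∫ s in (0:ℝ)..t, S s) = S := funext fun t => (hd t).deriv
  refine ⟨fun t => ∫ s in (0:ℝ)..t, S s, ?_, ?_, ?_, ?_⟩
  · rw [contDiff_infty_iff_deriv, hd']
    exact ⟨fun t => (hd t).differentiableAt, h1⟩
  · intro t ht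
    have : ∫ s in (0:ℝ)..t, S s = ∫ s in (0:ℝ)..t, (0:ℝ) := by
      apply intervalIntegral.integral_congr
      intro s hs
      apply h4
      have := abs_sub_left_of_mem_uIcc hs
      simpa using this.trans (by simpa using ht)
    simpa using this
  · intro t
    have e : (∫ s in (0:ℝ)..t, S s) - t = ∫ s in (0:ℝ)..t, (S s - 1) := by
      rw [intervalIntegral.integral_sub (hc.intervalIntegrable _ _) (by simp)]; simp
    rw [e]
    -- the function s ↦ S s - 1 vanishes for |s| ≥ ε
    have hci : Continuous fun s => S s - 1 := by fun_prop
    have key : ∀ b, |b| ≤ ε → |∫ s in (0:ℝ)..b, (S s - 1)| ≤ ε := by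
      intro b hb
      have := intervalIntegral.norm_integral_le_of_norm_le_const (a := 0) (b := b) (C := 1)
        (f := fun s => S s - 1) (fun s _ => by
          rw [Real.norm_eq_abs, abs_le]; constructor <;> linarith [h2 s, h3 s])
      rw [Real.norm_eq_abs] at this
      simp at this
      linarith
    by_cases ht : |t| ≤ ε
    · exact key t ht
    · push Not at ht
      rcases lt_abs.1 ht with h | h
      · rw [← intervalIntegral.integral_add_adjacent_intervals (b := ε)
          (hci.intervalIntegrable _ _) (hci.intervalIntegrable _ _)]
        have : ∫ s in ε..t, (S s - 1) = ∫ s in ε..t, (0:ℝ) := by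
          apply intervalIntegral.integral_congr
          intro s hs
          rw [uIcc_of_le h.le] at hs
          simp [h5 s (hs.1.trans (le_abs_self s))]
        rw [this]
        simpa using key ε (by rw [abs_of_pos hε])
      · rw [← intervalIntegral.integral_add_adjacent_intervals (b := -ε)
          (hci.intervalIntegrable _ _) (hci.intervalIntegrable _ _)]
        have : ∫ s in (-ε)..t, (S s - 1) = ∫ s in (-ε)..t, (0:ℝ) := by
          apply intervalIntegral.integral_congr
          intro s hs
          rw [uIcc_of_ge (by linarith)] at hs
          have : ε ≤ -s := by linarith [hs.2]
          simp [h5 s (this.trans (neg_le_abs s))]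
        rw [this]
        simpa using key (-ε) (by rw [abs_neg, abs_of_pos hε])
  · intro t
    rw [hd', abs_of_nonneg (h2 t)]
    exact h3 t

lemma norm_grad (f : Euc d → ℝ) (x : Euc d) : ‖gradient f x‖ = ‖fderiv ℝ f x‖ := by
  simp [gradient]

lemma TestFun.comp {Ω : Set (Euc d)} {φ : Euc d → ℝ} (h : TestFun Ω φ) {T : ℝ → ℝ}
    (hT : ContDiff ℝ (⊤ : ℕ∞) T) (h0 : T 0 = 0) : TestFun Ω (fun x => T (φ x)) := by
  refine ⟨hT.comp h.1, h.2.1.comp_left h0, ?_⟩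
  refine (closure_mono ?_).trans h.2.2
  intro x hx hx'
  apply hx
  simp [hx', h0]

lemma norm_grad_comp {φ : Euc d → ℝ} (h : ContDiff ℝ (⊤ : ℕ∞) φ) {T : ℝ → ℝ}
    (hT : ContDiff ℝ (⊤ : ℕ∞) T) (x : Euc d) :
    ‖gradient (fun x => T (φ x)) x‖ = |deriv T (φ x)| * ‖gradient φ x‖ := by
  rw [norm_grad, norm_grad]
  have h1 : HasFDerivAt (T ∘ φ) (deriv T (φ x) • fderiv ℝ φ x) x :=
    HasDerivAt.comp_hasFDerivAt x ((hT.differentiable (by simp)) _).hasDerivAt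
      ((h.differentiable (by simp)) x).hasFDerivAt
  have h2 : fderiv ℝ (fun x => T (φ x)) x = deriv T (φ x) • fderiv ℝ φ x := h1.fderiv
  rw [h2, norm_smul, Real.norm_eq_abs]

lemma TestFun.continuous_grad {Ω : Set (Euc d)} {φ : Euc d → ℝ} (h : TestFun Ω φ) :
    Continuous (fun x => gradient φ x) := by
  unfold gradient
  have := h.1.continuous_fderiv (by simp)
  fun_prop

lemma TestFun.hcs_grad {Ω : Set (Euc d)} {φ : Euc d → ℝ} (h : TestFun Ω φ) :
    HasCompactSupport (fun x => gradient φ x) := by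
  unfold gradient
  exact (h.2.1.fderiv ℝ).comp_left (g := (InnerProductSpace.toDual ℝ (Euc d)).symm) (map_zero _)

lemma TestFun.memLp {Ω : Set (Euc d)} {φ : Euc d → ℝ} (h : TestFun Ω φ) :
    MemLp φ 2 (volume : Measure (Euc d)) :=
  h.1.continuous.memLp_of_hasCompactSupport h.2.1

lemma TestFun.memLp_grad {Ω : Set (Euc d)} {φ : Euc d → ℝ} (h : TestFun Ω φ) :
    MemLp (fun x => gradient φ x) 2 (volume : Measure (Euc d)) :=
  h.continuous_grad.memLp_of_hasCompactSupport h.hcs_grad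

lemma MemLp.int_sq {F : Type*} [NormedAddCommGroup F] {f : Euc d → F}
    (h : MemLp f 2 (volume : Measure (Euc d))) : Integrable (fun x => ‖f x‖ ^ 2) :=
  (memLp_two_iff_integrable_sq_norm h.1).1 h

lemma TestFun.memH10 {Ω : Set (Euc d)} {φ : Euc d → ℝ} (h : TestFun Ω φ) : MemH10 Ω φ :=
  ⟨h.memLp, h.memLp_grad, fun _ => φ, fun _ => h, by simp⟩

lemma lam1_nonneg (Ω : Set (Euc d)) : 0 ≤ lam1 Ω := by
  apply Real.sInf_nonneg
  rintro t ⟨v, -, -, rfl⟩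
  positivity

lemma lam1_le_test {Ω : Set (Euc d)} {φ : Euc d → ℝ} (h : TestFun Ω φ) :
    lam1 Ω * ∫ x, (φ x) ^ 2 ≤ ∫ x, ‖gradient φ x‖ ^ 2 := by
  by_cases h0 : ∫ x, (φ x) ^ 2 = 0
  · rw [h0, mul_zero]; positivity
  have hpos : 0 < ∫ x, (φ x) ^ 2 := lt_of_le_of_ne (by positivity) (Ne.symm h0)
  set I := ∫ x, (φ x) ^ 2 with hI
  set c : ℝ := (Real.sqrt I)⁻¹ with hc
  have hc2 : c ^ 2 = I⁻¹ := by rw [hc, inv_pow, Real.sq_sqrt hpos.le]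
  have hT : ContDiff ℝ (⊤ : ℕ∞) (fun t : ℝ => c * t) := by fun_prop
  have hd : ∀ t : ℝ, deriv (fun t : ℝ => c * t) t = c := fun t => by
    simpa using ((hasDerivAt_id t).const_mul c).deriv
  have h1 := h.comp hT (by simp)
  have : lam1 Ω ≤ ∫ x, ‖gradient (fun x => c * φ x) x‖ ^ 2 := by
    apply csInf_le
    · refine ⟨0, ?_⟩
      rintro t ⟨v, -, -, rfl⟩
      positivity
    · refine ⟨_, h1.memH10, ?_, rfl⟩
      simp_rw [mul_pow]
      rw [integral_const_mul, hc2, ← hI, inv_mul_cancel₀ h0]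
  have e : ∫ x, ‖gradient (fun x => c * φ x) x‖ ^ 2 = c ^ 2 * ∫ x, ‖gradient φ x‖ ^ 2 := by
    rw [← integral_const_mul]
    congr 1
    ext x
    rw [norm_grad_comp h.1 hT, hd, mul_pow, sq_abs]
  rw [e, hc2, inv_mul_eq_div, le_div_iff₀ hpos] at this
  exact this

lemma exists_ext (i : Fin d) {D Ω' : Set (Euc d)} {a : ℝ} (hD : IsOpen D)
    (hDb : Bornology.IsBounded D) (ha' : a < mvol D) (hΩ : IsOpen Ω') (hs : Ω' ⊆ D)
    (hm : mvol Ω' ≤ a) : ∃ Ω'' : Set (Euc d), IsOpen Ω'' ∧ Ω'' ⊆ D ∧ Ω' ⊆ Ω'' ∧ mvol Ω'' = a := by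
  have : Nonempty (Fin d) := ⟨i⟩
  obtain ⟨R, hR0, hR⟩ : ∃ R : ℝ, 0 < R ∧ D ⊆ ball 0 R := by
    obtain ⟨R, hR⟩ := hDb.subset_ball (0 : Euc d)
    exact ⟨max R 1, by positivity, hR.trans (ball_subset_ball (le_max_left _ _))⟩
  have hDfin : volume D ≠ ∞ := hDb.measure_lt_top.ne
  set f : ℝ → ℝ := fun r => mvol (Ω' ∪ (D ∩ ball 0 r)) with hf
  have hsub : ∀ r, Ω' ∪ (D ∩ ball 0 r) ⊆ D := fun r => union_subset hs inter_subset_left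
  have hfin : ∀ r, volume (Ω' ∪ (D ∩ ball 0 r)) ≠ ∞ := fun r =>
    ne_top_of_le_ne_top hDfin (measure_mono (hsub r))
  set g : ℝ → ℝ := fun r => r ^ d * mvol (ball (0 : Euc d) 1) with hg
  have hgb : ∀ r, 0 ≤ r → mvol (ball (0 : Euc d) r) = g r := by
    intro r hr
    rw [mvol, Measure.addHaar_ball _ _ hr, ENNReal.toReal_mul, ENNReal.toReal_ofReal (by positivity)]
    simp [g, mvol]
  have hmono : ∀ r s, r ≤ s → f r ≤ f s := by
    intro r s hrs
    apply ENNReal.toReal_mono (hfin s)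
    apply measure_mono
    exact union_subset_union_right _ (inter_subset_inter_right _ (ball_subset_ball hrs))
  have hinc : ∀ r s, 0 ≤ r → r ≤ s → f s ≤ f r + (g s - g r) := by
    intro r s hr hrs
    rw [← hgb r hr, ← hgb s (hr.trans hrs)]
    have e : mvol (ball (0 : Euc d) s) - mvol (ball (0 : Euc d) r)
        = volume.real (ball (0 : Euc d) s \ ball 0 r) := by
      rw [measureReal_sdiff (ball_subset_ball hrs) measurableSet_ball]
      rfl
    rw [e]
    refine le_trans ?_ (measureReal_union_le _ _)
    apply measureReal_mono
    · rintro x (hx | hx)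
      · exact Or.inl (Or.inl hx)
      · by_cases h : x ∈ ball (0 : Euc d) r
        · exact Or.inl (Or.inr ⟨hx.1, h⟩)
        · exact Or.inr ⟨hx.2, h⟩
    · exact (measure_union_lt_top (hfin r).lt_top
        ((measure_mono sdiff_subset).trans_lt measure_ball_lt_top)).ne
  have habs : ∀ r s, 0 ≤ r → 0 ≤ s → |f s - f r| ≤ |g s - g r| := by
    intro r s hr hs
    rcases le_total r s with h | h
    · rw [abs_of_nonneg (by linarith [hmono r s h])]
      exact le_trans (by linarith [hinc r s hr h]) (le_abs_self _)
    · rw [abs_of_nonpos (by linarith [hmono s r h])]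
      exact le_trans (by linarith [hinc s r hs h]) (neg_le_abs _)
  have hgc : Continuous g := by fun_prop
  have hcont : ContinuousOn f (Icc 0 R) := by
    intro r hr
    rw [ContinuousWithinAt, tendsto_iff_norm_sub_tendsto_zero]
    have h1 : Tendsto (fun s => |g s - g r|) (𝓝[Icc 0 R] r) (𝓝 0) := by
      have : Continuous fun s => |g s - g r| := by fun_prop
      have := this.tendsto r
      simp only [sub_self, abs_zero] at this
      exact this.mono_left nhdsWithin_le_nhds
    refine squeeze_zero' (Filter.Eventually.of_forall fun _ => norm_nonneg _) ?_ h1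
    filter_upwards [self_mem_nhdsWithin] with s hs
    exact habs r s hr.1 hs.1
  have h0 : f 0 = mvol Ω' := by simp [f]
  have hRR : f R = mvol D := by
    simp only [f]
    rw [inter_eq_left.2 hR, union_eq_right.2 hs]
  obtain ⟨r, -, hr⟩ := intermediate_value_Icc hR0.le hcont
    (show a ∈ Icc (f 0) (f R) from ⟨by rw [h0]; exact hm, by rw [hRR]; exact ha'.le⟩)
  exact ⟨_, hΩ.union (hD.inter isOpen_ball), hsub r, subset_union_left, hr⟩

lemma poincare (i : Fin d) {D : Set (Euc d)} {φ : Euc d → ℝ} {R : ℝ} (hR0 : 0 ≤ R)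
    (hR : D ⊆ closedBall 0 R) (h : TestFun D φ) :
    ∫ x, (φ x) ^ 2 ≤ 4 * R ^ 2 * ∫ x, ‖gradient φ x‖ ^ 2 := by
  set e : Euc d := EuclideanSpace.single i 1 with he
  have hdiff : Differentiable ℝ φ := h.1.differentiable (by simp)
  have hc : Continuous φ := h.1.continuous
  have hdf : ∀ x, fderiv ℝ (fun x => φ x ^ 2) x e = 2 * φ x * fderiv ℝ φ x e := by
    intro x
    have := ((hdiff x).hasFDerivAt.pow 2).fderiv
    have h2 : fderiv ℝ (fun x => φ x ^ 2) x = _ := this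
    rw [h2]; simp
  have hg : ∀ x, HasFDerivAt (fun x : Euc d => x i)
      (EuclideanSpace.proj i : Euc d →L[ℝ] ℝ) x := fun x =>
    (EuclideanSpace.proj i : Euc d →L[ℝ] ℝ).hasFDerivAt
  have hdg : ∀ x, fderiv ℝ (fun x : Euc d => x i) x e = 1 := by
    intro x; rw [(hg x).fderiv]; simp [e]
  have hcd : Continuous (fun x => fderiv ℝ φ x e) := by
    have := h.1.continuous_fderiv (by simp)
    fun_prop
  have hci : Continuous fun x : Euc d => x i := by fun_prop
  have hint : Integrable (fun x => 2 * φ x * fderiv ℝ φ x e * x i) := by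
    apply Continuous.integrable_of_hasCompactSupport
    · fun_prop
    · apply HasCompactSupport.mul_right
      apply HasCompactSupport.mul_right
      exact h.2.1.mul_left
  have ibp := integral_mul_fderiv_eq_neg_fderiv_mul_of_integrable (μ := (volume : Measure (Euc d)))
    (f := fun x => φ x ^ 2) (g := fun x : Euc d => x i) (v := e)
    (by
      simp_rw [hdf]
      exact hint)
    (by
      simp_rw [hdg, mul_one]
      exact h.memLp.integrable_sq)
    (by
      apply Continuous.integrable_of_hasCompactSupport
      · fun_prop
      · apply HasCompactSupport.mul_right
        exact h.2.1.comp_left (g := fun t : ℝ => t ^ 2) (by simp))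
    (fun x _ => (hdiff x).pow 2)
    (fun x _ => (hg x).differentiableAt)
  simp_rw [hdg, hdf, mul_one] at ibp
  have hI1 := h.memLp.integrable_sq
  have hI2 := MemLp.int_sq h.memLp_grad
  have hb : -∫ x, 2 * φ x * fderiv ℝ φ x e * x i ≤
      ∫ x, (1 / 2 * (φ x) ^ 2 + 2 * R ^ 2 * ‖gradient φ x‖ ^ 2) := by
    rw [← integral_neg]
    apply integral_mono hint.neg ((hI1.const_mul _).add (hI2.const_mul _))
    intro x
    show -(2 * φ x * fderiv ℝ φ x e * x i) ≤ 1 / 2 * (φ x) ^ 2 + 2 * R ^ 2 * ‖gradient φ x‖ ^ 2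
    by_cases hx : φ x = 0
    · rw [hx]; simp; positivity
    have hxD : x ∈ D := h.2.2 (subset_tsupport _ hx)
    have hxR : ‖x‖ ≤ R := by simpa using hR hxD
    have hxi : |x i| ≤ R := (PiLp.norm_apply_le x i).trans hxR
    have hde : |fderiv ℝ φ x e| ≤ ‖gradient φ x‖ := by
      rw [norm_grad]
      have := (fderiv ℝ φ x).le_opNorm e
      simpa [e] using this
    have hp : |fderiv ℝ φ x e * x i| ≤ ‖gradient φ x‖ * R := by
      rw [abs_mul]; gcongr
    have hsq : (fderiv ℝ φ x e * x i) ^ 2 ≤ (‖gradient φ x‖ * R) ^ 2 := by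
      rw [← sq_abs]; gcongr
    nlinarith [sq_nonneg (φ x + 2 * (fderiv ℝ φ x e * x i))]
  rw [← ibp, integral_add (hI1.const_mul _) (hI2.const_mul _), integral_const_mul,
    integral_const_mul] at hb
  linarith

lemma eLp_two {F : Type*} [NormedAddCommGroup F] {f : Euc d → F}
    (h : MemLp f 2 (volume : Measure (Euc d))) :
    eLpNorm f 2 volume = ENNReal.ofReal (Real.sqrt (∫ x, ‖f x‖ ^ 2)) := by
  rw [h.eLpNorm_eq_integral_rpow_norm (by simp) (by simp), Real.sqrt_eq_rpow]
  simp

lemma tendsto_sq {F : Type*} [NormedAddCommGroup F] {f : Euc d → F} {g : ℕ → Euc d → F}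
    (h : MemLp f 2 (volume : Measure (Euc d))) (hg : ∀ n, MemLp (g n) 2 (volume : Measure (Euc d)))
    (ht : Tendsto (fun n => ∫ x, ‖f x - g n x‖ ^ 2) atTop (𝓝 0)) :
    Tendsto (fun n => ∫ x, ‖g n x‖ ^ 2) atTop (𝓝 (∫ x, ‖f x‖ ^ 2)) := by
  have hN : ∀ {k : Euc d → F} (hk : MemLp k 2 (volume : Measure (Euc d))),
      ‖hk.toLp k‖ = Real.sqrt (∫ x, ‖k x‖ ^ 2) := by
    intro k hk
    rw [Lp.norm_toLp, eLp_two hk, ENNReal.toReal_ofReal (Real.sqrt_nonneg _)]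
  have hS : ∀ {k : Euc d → F} (hk : MemLp k 2 (volume : Measure (Euc d))),
      ‖hk.toLp k‖ ^ 2 = ∫ x, ‖k x‖ ^ 2 := by
    intro k hk
    rw [hN, Real.sq_sqrt (by positivity)]
  have h1 : Tendsto (fun n => (hg n).toLp (g n)) atTop (𝓝 (h.toLp f)) := by
    rw [tendsto_iff_norm_sub_tendsto_zero]
    have e : ∀ n, ‖(hg n).toLp (g n) - h.toLp f‖ = Real.sqrt (∫ x, ‖f x - g n x‖ ^ 2) := by
      intro n
      rw [norm_sub_rev, ← MemLp.toLp_sub h (hg n), hN]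
      rfl
    simp_rw [e]
    have hz := (Real.continuous_sqrt.tendsto 0).comp ht
    rw [Real.sqrt_zero] at hz
    exact hz
  have h2 := (h1.norm).pow 2
  rw [hS] at h2
  exact h2.congr fun n => hS (hg n)

lemma MemH10.seq {D : Set (Euc d)} {v : Euc d → ℝ} (h : MemH10 D v) :
    ∃ φ : ℕ → Euc d → ℝ, (∀ n, TestFun D (φ n)) ∧
      TendstoInMeasure volume φ atTop v ∧
      (∀ᵐ x, Tendsto (fun n => φ n x) atTop (𝓝 (v x))) ∧
      Tendsto (fun n => ∫ x, (φ n x) ^ 2) atTop (𝓝 (∫ x, (v x) ^ 2)) ∧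
      Tendsto (fun n => ∫ x, ‖gradient v x - gradient (φ n) x‖ ^ 2) atTop (𝓝 0) ∧
      Tendsto (fun n => ∫ x, ‖gradient (φ n) x‖ ^ 2) atTop (𝓝 (∫ x, ‖gradient v x‖ ^ 2)) := by
  obtain ⟨hv, hgv, φ, hφ, ht⟩ := h
  have i1 : ∀ n, Integrable (fun x => (v x - φ n x) ^ 2) := fun n =>
    (hv.sub (hφ n).memLp).integrable_sq
  have i2 : ∀ n, Integrable (fun x => ‖gradient v x - gradient (φ n) x‖ ^ 2) := fun n =>
    MemLp.int_sq (hgv.sub (hφ n).memLp_grad)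
  have t1 : Tendsto (fun n => ∫ x, (v x - φ n x) ^ 2) atTop (𝓝 0) := by
    refine squeeze_zero (fun n => by positivity) (fun n => ?_) ht
    apply integral_mono (i1 n) ((i1 n).add (i2 n))
    intro x
    show _ ≤ (v x - φ n x) ^ 2 + ‖gradient v x - gradient (φ n) x‖ ^ 2
    nlinarith [sq_nonneg ‖gradient v x - gradient (φ n) x‖]
  have t2 : Tendsto (fun n => ∫ x, ‖gradient v x - gradient (φ n) x‖ ^ 2) atTop (𝓝 0) := by
    refine squeeze_zero (fun n => by positivity) (fun n => ?_) ht
    apply integral_mono (i2 n) ((i1 n).add (i2 n))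
    intro x
    show _ ≤ (v x - φ n x) ^ 2 + ‖gradient v x - gradient (φ n) x‖ ^ 2
    nlinarith [sq_nonneg (v x - φ n x)]
  have t3 : TendstoInMeasure volume φ atTop v := by
    apply tendstoInMeasure_of_tendsto_eLpNorm (p := 2) (by simp) (fun n => (hφ n).memLp.1) hv.1
    have : ∀ n, eLpNorm (φ n - v) 2 volume
        = ENNReal.ofReal (Real.sqrt (∫ x, (v x - φ n x) ^ 2)) := by
      intro n
      rw [eLpNorm_sub_comm, eLp_two (hv.sub (hφ n).memLp)]
      simp
    simp_rw [this]
    have h0 : Continuous fun t : ℝ => ENNReal.ofReal (Real.sqrt t) :=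
      ENNReal.continuous_ofReal.comp Real.continuous_sqrt
    have hz := (h0.tendsto 0).comp t1
    simp only [Real.sqrt_zero, ENNReal.ofReal_zero] at hz
    exact hz
  have t4 : Tendsto (fun n => ∫ x, (φ n x) ^ 2) atTop (𝓝 (∫ x, (v x) ^ 2)) := by
    have := tendsto_sq hv (fun n => (hφ n).memLp) (by simpa using t1)
    simpa using this
  have t5 := tendsto_sq hgv (fun n => (hφ n).memLp_grad) t2
  obtain ⟨ns, hns, hae⟩ := t3.exists_seq_tendsto_ae
  have hh := hns.tendsto_atTop
  exact ⟨fun n => φ (ns n), fun n => hφ _, fun ε hε => (t3 ε hε).comp hh, hae, t4.comp hh,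
    t2.comp hh, t5.comp hh⟩

lemma strict_layer (i : Fin d) {D : Set (Euc d)} {v : Euc d → ℝ} (hD : IsOpen D)
    (hDb : Bornology.IsBounded D)
    (h : MemH10 D v) (h0 : ∫ x, (v x) ^ 2 ≠ 0) {ε : ℝ} (hε : 0 < ε) :
    volume {x | x ∈ D ∧ 0 < |v x| ∧ |v x| ≤ ε} ≠ 0 := by
  intro hz
  apply h0
  have hv := h.1
  have hgv := h.2.1
  obtain ⟨φ, hφ, -, hae, -, t2, -⟩ := h.seq
  obtain ⟨S, s1, s2, s3, s4, s5, s6, s7, C, hC0, hC⟩ := exists_step ε hε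
  have hS0 : S 0 = 0 := s4 0 (by simp; positivity)
  have hSc : Continuous S := s1.continuous
  have hSd : Continuous (deriv S) := s1.continuous_deriv (by simp)
  -- v = 0 a.e. outside D
  have hφD : ∀ n x, x ∉ D → φ n x = 0 := by
    intro n x hx
    by_contra hne
    exact hx ((hφ n).2.2 (subset_tsupport _ hne))
  have hout : ∀ᵐ x, x ∉ D → v x = 0 := by
    filter_upwards [hae] with x hx hxD
    simp_rw [hφD _ x hxD] at hx
    exact (tendsto_nhds_unique hx tendsto_const_nhds)
  have hin : ∀ᵐ x, ¬ (x ∈ D ∧ 0 < |v x| ∧ |v x| ≤ ε) := by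
    rw [ae_iff]; simpa using hz
  have hval : ∀ᵐ x, v x = 0 ∨ ε ≤ |v x| := by
    filter_upwards [hout, hin] with x h1 h2
    by_cases hx : x ∈ D
    · by_contra hcon
      push Not at hcon
      exact h2 ⟨hx, abs_pos.2 hcon.1, hcon.2.le⟩
    · exact Or.inl (h1 hx)
  have hdv : ∀ᵐ x, deriv S (v x) = 0 := by
    filter_upwards [hval] with x hx
    rcases hx with hx | hx
    · rw [hx]; exact s6 0 hS0
    · exact s7 _ (s5 _ hx)
  have hIgv := MemLp.int_sq hgv
  -- energy in the layer tends to zero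
  have e1 : Tendsto (fun n => ∫ x, (deriv S (φ n x)) ^ 2 * ‖gradient v x‖ ^ 2) atTop (𝓝 0) := by
    have : (0:ℝ) = ∫ x, (deriv S (v x)) ^ 2 * ‖gradient v x‖ ^ 2 := by
      rw [← integral_zero (Euc d) ℝ (μ := volume)]
      apply integral_congr_ae
      filter_upwards [hdv] with x hx
      simp [hx]
    rw [this]
    apply tendsto_integral_of_dominated_convergence (fun x => C ^ 2 * ‖gradient v x‖ ^ 2)
    · intro n
      have := (hφ n).1.continuous
      exact (Continuous.aestronglyMeasurable (by fun_prop)).mul hIgv.1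
    · exact hIgv.const_mul _
    · intro n
      refine Filter.Eventually.of_forall fun x => ?_
      rw [Real.norm_of_nonneg (by positivity)]
      refine mul_le_mul_of_nonneg_right ?_ (by positivity)
      rw [← sq_abs]
      gcongr
      exact hC _
    · filter_upwards [hae] with x hx
      exact (((hSd.tendsto _).comp hx).pow 2).mul_const _
  have e2 : ∀ n, ∫ x, ‖gradient (fun y => S (φ n y)) x‖ ^ 2 ≤
      2 * C ^ 2 * (∫ x, ‖gradient v x - gradient (φ n) x‖ ^ 2) +
      2 * ∫ x, (deriv S (φ n x)) ^ 2 * ‖gradient v x‖ ^ 2 := by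
    intro n
    have j1 : Integrable (fun x => ‖gradient v x - gradient (φ n) x‖ ^ 2) :=
      MemLp.int_sq (hgv.sub (hφ n).memLp_grad)
    have j2 : Integrable (fun x => (deriv S (φ n x)) ^ 2 * ‖gradient v x‖ ^ 2) := by
      refine (hIgv.const_mul (C ^ 2)).mono' ?_ ?_
      · have := (hφ n).1.continuous
        exact (Continuous.aestronglyMeasurable (by fun_prop)).mul hIgv.1
      · refine Filter.Eventually.of_forall fun x => ?_
        rw [Real.norm_of_nonneg (by positivity)]
        refine mul_le_mul_of_nonneg_right ?_ (by positivity)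
        rw [← sq_abs]
        gcongr
        exact hC _
    rw [← integral_const_mul, ← integral_const_mul,
      ← integral_add (j1.const_mul _) (j2.const_mul _)]
    apply integral_mono (MemLp.int_sq ((hφ n).comp s1 hS0).memLp_grad)
      ((j1.const_mul _).add (j2.const_mul _))
    intro x
    show ‖gradient (fun y => S (φ n y)) x‖ ^ 2 ≤
      2 * C ^ 2 * ‖gradient v x - gradient (φ n) x‖ ^ 2 +
      2 * ((deriv S (φ n x)) ^ 2 * ‖gradient v x‖ ^ 2)
    rw [norm_grad_comp (hφ n).1 s1, mul_pow, sq_abs]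
    have k1 : ‖gradient (φ n) x‖ ≤ ‖gradient v x - gradient (φ n) x‖ + ‖gradient v x‖ := by
      have := norm_sub_le (gradient v x) (gradient v x - gradient (φ n) x)
      simp only [sub_sub_cancel] at this
      linarith
    have k2 : ‖gradient (φ n) x‖ ^ 2 ≤
        2 * ‖gradient v x - gradient (φ n) x‖ ^ 2 + 2 * ‖gradient v x‖ ^ 2 := by
      have : ‖gradient (φ n) x‖ ^ 2 ≤
        (‖gradient v x - gradient (φ n) x‖ + ‖gradient v x‖) ^ 2 := by gcongr
      nlinarith [sq_nonneg (‖gradient v x - gradient (φ n) x‖ - ‖gradient v x‖)]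
    have k3 : (deriv S (φ n x)) ^ 2 ≤ C ^ 2 := by
      rw [← sq_abs]
      gcongr
      exact hC _
    have k4 := mul_le_mul_of_nonneg_left k2 (sq_nonneg (deriv S (φ n x)))
    have k5 := mul_le_mul_of_nonneg_right k3 (sq_nonneg ‖gradient v x - gradient (φ n) x‖)
    nlinarith
  obtain ⟨R, hR0, hR⟩ : ∃ R : ℝ, 0 ≤ R ∧ D ⊆ closedBall 0 R := by
    obtain ⟨R, hR⟩ := hDb.subset_closedBall (0 : Euc d)
    exact ⟨max R 0, le_max_right _ _, hR.trans (closedBall_subset_closedBall (le_max_left _ _))⟩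
  have e3 : Tendsto (fun n => ∫ x, (S (φ n x)) ^ 2) atTop (𝓝 0) := by
    have hlim : Tendsto (fun n => 4 * R ^ 2 *
      (2 * C ^ 2 * (∫ x, ‖gradient v x - gradient (φ n) x‖ ^ 2) +
      2 * ∫ x, (deriv S (φ n x)) ^ 2 * ‖gradient v x‖ ^ 2)) atTop (𝓝 0) := by
      simpa using ((t2.const_mul (2 * C ^ 2)).add (e1.const_mul 2)).const_mul (4 * R ^ 2)
    refine squeeze_zero (fun n => by positivity) (fun n => ?_) hlim
    exact (poincare i hR0 hR ((hφ n).comp s1 hS0)).trans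
      (mul_le_mul_of_nonneg_left (e2 n) (by positivity))
  have e4 : Tendsto (fun n => ∫ x, (S (φ n x)) ^ 2) atTop (𝓝 (∫ x, (S (v x)) ^ 2)) := by
    apply tendsto_integral_of_dominated_convergence (D.indicator fun _ => (1:ℝ))
    · intro n
      have := (hφ n).1.continuous
      exact Continuous.aestronglyMeasurable (by fun_prop)
    · rw [integrable_indicator_iff hD.measurableSet]
      exact integrableOn_const hDb.measure_lt_top.ne
    · intro n
      refine Filter.Eventually.of_forall fun x => ?_
      rw [Real.norm_of_nonneg (by positivity)]
      by_cases hx : x ∈ D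
      · rw [indicator_of_mem hx]
        exact pow_le_one₀ (s2 _) (s3 _)
      · rw [indicator_of_notMem hx, hφD n x hx, hS0]; simp
    · filter_upwards [hae] with x hx
      exact ((hSc.tendsto _).comp hx).pow 2
  have e5 : ∫ x, (S (v x)) ^ 2 = 0 := tendsto_nhds_unique e4 e3
  have hSi : Integrable (fun x => (S (v x)) ^ 2) := by
    have : Integrable (D.indicator fun _ : Euc d => (1:ℝ)) := by
      rw [integrable_indicator_iff hD.measurableSet]
      exact integrableOn_const hDb.measure_lt_top.ne
    refine this.mono' ((hSc.comp_aestronglyMeasurable hv.1).pow 2) ?_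
    filter_upwards [hout] with x hx
    rw [Real.norm_of_nonneg (by positivity)]
    by_cases hxD : x ∈ D
    · rw [indicator_of_mem hxD]
      exact pow_le_one₀ (s2 _) (s3 _)
    · rw [indicator_of_notMem hxD, hx hxD, hS0]; simp
  have e6 := (integral_eq_zero_iff_of_nonneg (fun x => sq_nonneg (S (v x))) hSi).1 e5
  rw [← integral_zero (Euc d) ℝ (μ := volume)]
  apply integral_congr_ae
  filter_upwards [hval, e6] with x h1 h2
  rcases h1 with h1 | h1
  · simp [h1]
  · rw [s5 _ h1] at h2; simp at h2

lemma main_ineq (i : Fin d) {D Ωstar : Set (Euc d)} {a : ℝ} {v : Euc d → ℝ} (hD : IsOpen D)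
    (hDb : Bornology.IsBounded D) (ha' : a < mvol D)
    (hopt : IsOptimalShape D a Ωstar) (h : MemH10 D v) (hm : mvol (Om D v) ≤ a) :
    lam1 Ωstar * ∫ x, (v x) ^ 2 ≤ ∫ x, ‖gradient v x‖ ^ 2 := by
  by_cases h0 : ∫ x, (v x) ^ 2 = 0
  · rw [h0, mul_zero]; positivity
  have hDfin : volume D ≠ ∞ := hDb.measure_lt_top.ne
  obtain ⟨φ, hφ, hmeas, -, t1, -, t3⟩ := h.seq
  have hlam := lam1_nonneg Ωstar
  have hφD : ∀ n x, φ n x ≠ 0 → x ∈ D := fun n x hne => (hφ n).2.2 (subset_tsupport _ hne)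
  have key : ∀ ε : ℝ, 0 < ε →
      lam1 Ωstar * ((1 - ε) * (∫ x, (v x) ^ 2) - ε * mvol D) ≤ ∫ x, ‖gradient v x‖ ^ 2 := by
    intro ε hε
    obtain ⟨T, hT1, hT2, hT3, hT4⟩ := exists_trunc ε hε
    have hT0 : T 0 = 0 := hT2 0 (by simp; positivity)
    -- strict volume inequality
    have hvol : volume {x | x ∈ D ∧ ε / 8 < |v x|} < ENNReal.ofReal a := by
      have hlay := strict_layer i hD hDb h h0 (ε := ε / 8) (by positivity)
      have hun : Om D v = {x | x ∈ D ∧ ε / 8 < |v x|} ∪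
          {x | x ∈ D ∧ 0 < |v x| ∧ |v x| ≤ ε / 8} := by
        ext x
        simp only [Om, mem_ofPred_eq, mem_union]
        constructor
        · rintro ⟨hx, hne⟩
          rcases lt_or_ge (ε / 8) (|v x|) with hh | hh
          · exact Or.inl ⟨hx, hh⟩
          · exact Or.inr ⟨hx, abs_pos.2 hne, hh⟩
        · rintro (⟨hx, hh⟩ | ⟨hx, hh, -⟩)
          · exact ⟨hx, abs_pos.1 (lt_trans (by positivity) hh)⟩
          · exact ⟨hx, abs_pos.1 hh⟩
      have hnull : NullMeasurableSet {x | x ∈ D ∧ 0 < |v x| ∧ |v x| ≤ ε / 8} volume := by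
        have hB : MeasurableSet {t : ℝ | 0 < |t| ∧ |t| ≤ ε / 8} := by measurability
        exact hD.measurableSet.nullMeasurableSet.inter
          (h.1.1.aemeasurable.nullMeasurable hB)
      have hdis : Disjoint {x | x ∈ D ∧ ε / 8 < |v x|}
          {x | x ∈ D ∧ 0 < |v x| ∧ |v x| ≤ ε / 8} := by
        rw [Set.disjoint_left]
        rintro x ⟨-, h1⟩ ⟨-, -, h2⟩
        exact absurd h1 (not_lt.2 h2)
      have hadd := measure_union₀ (μ := volume) hnull hdis.aedisjoint
      rw [← hun] at hadd
      have hOmfin : volume (Om D v) ≠ ∞ :=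
        ne_top_of_le_ne_top hDfin (measure_mono fun x hx => hx.1)
      have hOm : volume (Om D v) ≤ ENNReal.ofReal a := by
        rw [← ENNReal.ofReal_toReal hOmfin]
        exact ENNReal.ofReal_le_ofReal hm
      refine lt_of_lt_of_le ?_ hOm
      rw [hadd]
      apply ENNReal.lt_add_right _ hlay
      exact ne_top_of_le_ne_top hDfin (measure_mono fun x hx => hx.1)
    have hev : ∀ᶠ n in atTop, mvol {x | ε / 4 < |φ n x|} ≤ a := by
      have hq := hmeas (ENNReal.ofReal (ε / 8)) (by simpa using hε)
      have hq2 := hq.add_const (volume {x | x ∈ D ∧ ε / 8 < |v x|})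
      rw [zero_add] at hq2
      filter_upwards [hq2.eventually_lt_const hvol] with n hn
      have ha0 : 0 ≤ a := le_trans ENNReal.toReal_nonneg hm
      apply ENNReal.toReal_le_of_le_ofReal ha0
      refine le_trans ((measure_mono ?_).trans (measure_union_le _ _)) hn.le
      intro x hx
      have hxD : x ∈ D := hφD n x (abs_pos.1 (lt_trans (by positivity) hx))
      by_cases hxv : ε / 8 < |v x|
      · exact Or.inr ⟨hxD, hxv⟩
      · left
        show ENNReal.ofReal (ε / 8) ≤ edist (φ n x) (v x)
        rw [edist_dist, Real.dist_eq]
        apply ENNReal.ofReal_le_ofReal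
        have h1 : ε / 4 < |φ n x| := hx
        have h2 := abs_sub_abs_le_abs_sub (φ n x) (v x)
        push Not at hxv
        linarith
    have hlim := ((t1.const_mul (1 - ε)).sub_const (ε * mvol D)).const_mul (lam1 Ωstar)
    refine le_of_tendsto_of_tendsto hlim t3 ?_
    filter_upwards [hev] with n hn
    have hcφ : Continuous (φ n) := (hφ n).1.continuous
    have hopen : IsOpen {x | ε / 4 < |φ n x|} := isOpen_lt continuous_const hcφ.abs
    have hsubD : {x | ε / 4 < |φ n x|} ⊆ D := fun x hx =>
      hφD n x (abs_pos.1 (lt_trans (by positivity) hx))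
    obtain ⟨Ω'', o1, o2, o3, o4⟩ := exists_ext i hD hDb ha' hopen hsubD hn
    have hTD := (hφ n).comp hT1 hT0
    have htest : TestFun Ω'' (fun x => T (φ n x)) := by
      refine ⟨hTD.1, hTD.2.1, ?_⟩
      have hcl : IsClosed {x | ε / 2 ≤ |φ n x|} := isClosed_le continuous_const hcφ.abs
      have : tsupport (fun x => T (φ n x)) ⊆ {x | ε / 2 ≤ |φ n x|} := by
        apply closure_minimal _ hcl
        intro x hx
        by_contra hcon
        simp only [mem_ofPred_eq, not_le] at hcon
        exact hx (hT2 _ hcon.le)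
      refine this.trans (subset_trans ?_ o3)
      intro x hx
      have : ε / 2 ≤ |φ n x| := hx
      show ε / 4 < |φ n x|
      linarith
    have q1 := (mul_le_mul_of_nonneg_right (hopt.minim Ω'' o1 o2 o4)
      (show 0 ≤ ∫ x, (T (φ n x)) ^ 2 by positivity)).trans (lam1_le_test htest)
    have q2 : ∫ x, ‖gradient (fun x => T (φ n x)) x‖ ^ 2 ≤ ∫ x, ‖gradient (φ n) x‖ ^ 2 := by
      apply integral_mono (MemLp.int_sq hTD.memLp_grad) (MemLp.int_sq (hφ n).memLp_grad)
      intro x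
      show ‖gradient (fun x => T (φ n x)) x‖ ^ 2 ≤ ‖gradient (φ n) x‖ ^ 2
      rw [norm_grad_comp (hφ n).1 hT1]
      gcongr
      exact mul_le_of_le_one_left (norm_nonneg _) (hT4 _)
    have q3 : (1 - ε) * (∫ x, (φ n x) ^ 2) - ε * mvol D ≤ ∫ x, (T (φ n x)) ^ 2 := by
      have r1 := (hφ n).memLp.integrable_sq
      have r2 : Integrable (D.indicator fun _ : Euc d => (1:ℝ)) := by
        rw [integrable_indicator_iff hD.measurableSet]
        exact integrableOn_const hDfin
      have r3 : ∫ x, (D.indicator (fun _ : Euc d => (1:ℝ))) x = mvol D := by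
        rw [integral_indicator hD.measurableSet]
        simp [mvol, Measure.real]
      rw [← r3, ← integral_const_mul, ← integral_const_mul,
        ← integral_sub (r1.const_mul _) (r2.const_mul _)]
      apply integral_mono ((r1.const_mul _).sub (r2.const_mul _)) hTD.memLp.integrable_sq
      intro x
      show (1 - ε) * (φ n x) ^ 2 - ε * (D.indicator (fun _ : Euc d => (1:ℝ))) x ≤ (T (φ n x)) ^ 2
      by_cases hx : φ n x = 0
      · rw [hx, hT0]
        have : 0 ≤ (D.indicator (fun _ : Euc d => (1:ℝ))) x :=
          indicator_nonneg (fun _ _ => zero_le_one) x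
        nlinarith
      · rw [indicator_of_mem (hφD n x hx)]
        have h3 := abs_le.1 (hT3 (φ n x))
        set p := φ n x
        set q := T p
        have : -(ε * (p ^ 2 + 1)) ≤ 2 * p * (q - p) := by
          rcases le_total 0 p with hp | hp
          · nlinarith [mul_nonneg hp (by linarith [h3.1] : 0 ≤ q - p + ε),
              mul_nonneg hε.le (sq_nonneg (p - 1))]
          · nlinarith [mul_nonneg (neg_nonneg.2 hp) (by linarith [h3.2] : 0 ≤ ε - (q - p)),
              mul_nonneg hε.le (sq_nonneg (p + 1))]
        nlinarith [sq_nonneg (q - p)]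
    exact (mul_le_mul_of_nonneg_left q3 hlam).trans (q1.trans q2)
  have hcont : Continuous fun ε : ℝ =>
      lam1 Ωstar * ((1 - ε) * (∫ x, (v x) ^ 2) - ε * mvol D) := by fun_prop
  have hl : Tendsto (fun ε : ℝ => lam1 Ωstar * ((1 - ε) * (∫ x, (v x) ^ 2) - ε * mvol D))
      (𝓝[>] 0) (𝓝 (lam1 Ωstar * ∫ x, (v x) ^ 2)) := by
    have := hcont.tendsto 0
    simp only [sub_zero, one_mul, zero_mul] at this
    exact this.mono_left nhdsWithin_le_nhds
  refine le_of_tendsto hl ?_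
  filter_upwards [self_mem_nhdsWithin] with ε hε
  exact key ε hε

/-- Variational characterization: for an optimal shape `Ω*` with eigenfunction
`u` and `λ_a = λ₁(Ω*)`, one has `λ_a = ∫_D |∇u|² = min {∫_D |∇v|² : v ∈ H¹₀(D), ∫ v² = 1,
|Ω_v| ≤ a}`, and consequently `J(u) ≤ J(w)` for all `w ∈ H¹₀(D)` with `|Ω_w| ≤ a`. -/
theorem variational_characterization
    {d : ℕ} (D : Set (Euc d)) (a : ℝ) (Ωstar : Set (Euc d)) (u : Euc d → ℝ)
    (hD : IsOpen D) (hDb : Bornology.IsBounded D)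
    (ha : 0 < a) (ha' : a < mvol D)
    (hopt : IsOptimalShape D a Ωstar) (hu : IsFirstEigenfun Ωstar u) :
    lam1 Ωstar = (∫ x, ‖gradient u x‖ ^ 2) ∧
    (∀ v : Euc d → ℝ, MemH10 D v → (∫ x, (v x) ^ 2) = 1 → mvol (Om D v) ≤ a →
      lam1 Ωstar ≤ ∫ x, ‖gradient v x‖ ^ 2) ∧
    (∀ w : Euc d → ℝ, MemH10 D w → mvol (Om D w) ≤ a →
      Jfun (lam1 Ωstar) u ≤ Jfun (lam1 Ωstar) w) := by
  have hd : ∃ i : Fin d, True := by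
    by_contra hcon
    push Not at hcon
    have : IsEmpty (Fin d) := ⟨fun i => hcon i⟩
    have : Subsingleton (Euc d) := ⟨fun x y => by ext i; exact isEmptyElim i⟩
    rcases Ωstar.eq_empty_or_nonempty with he | hne
    · have := hopt.meas
      rw [he] at this
      simp [mvol] at this
      linarith
    · have h1 : Ωstar = univ := Subsingleton.eq_univ_of_nonempty hne
      have h2 : D = Ωstar := by
        rw [h1]
        exact eq_univ_of_univ_subset (h1 ▸ hopt.subset)
      rw [h2, hopt.meas] at ha'
      exact lt_irrefl _ ha'
  obtain ⟨i, -⟩ := hd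
  have hmain := fun (w : Euc d → ℝ) (hw : MemH10 D w) (hm : mvol (Om D w) ≤ a) =>
    main_ineq i hD hDb ha' hopt hw hm
  obtain ⟨hu1, hu2, hu3, hu4⟩ := hu
  refine ⟨hu3.symm, ?_, ?_⟩
  · intro v hv hv1 hm
    have := hmain v hv hm
    rwa [hv1, mul_one] at this
  · intro w hw hm
    have := hmain w hw hm
    unfold Jfun
    rw [hu2, hu3]
    linarith

end
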